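/- Let 𝒦 be a locally small category which has copowers (small copowers of every object) and finite intersections of subobjects. Then the free colimit completion 𝒫𝒦 is an elementary topos (finitely complete, cartesian closed, with a subobject classifier) if and only if 𝒦 is essentially small. -/

import Mathlib

/- Common definitions for formalizing "How nice are free completions of categories?"
   by Adámek and Rosický. -/

open CategoryTheory CategoryTheory.Limits

universe w w₁ w₂ v₁ u₁

namespace FreeCompletions

/-- A presheaf is *small* if it is a colimit of representables over a small
(`Type w`-indexed) diagram. -/
def IsSmallPresheaf {C : Type u₁} [Category.{v₁} C] (F : Cᵒᵖ ⥤ Type v₁) : Prop :=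
  ∃ (J : Type w) (_ : SmallCategory J) (D : J ⥤ C) (c : Cocone (D ⋙ yoneda)),
    Nonempty (IsColimit c) ∧ Nonempty (c.pt ≅ F)

/-- A presheaf is a (small) coproduct of representables. -/
def IsCoproductOfRepresentables {C : Type u₁} [Category.{v₁} C] (F : Cᵒᵖ ⥤ Type v₁) : Prop :=
  ∃ (I : Type v₁) (A : I → C), Nonempty (F ≅ ∐ fun i => yoneda.obj (A i))

/-- The free coproduct completion `Σ𝒦`, realized as the full subcategory of presheaves
consisting of coproducts of representables. -/
abbrev SigmaCompletion (K : Type u₁) [Category.{v₁} K] :=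
  ObjectProperty.FullSubcategory (IsCoproductOfRepresentables (C := K))

/-- The free colimit completion `𝒫𝒦`, the full subcategory of presheaves
consisting of the small presheaves. -/
abbrev PCompletion (K : Type u₁) [Category.{v₁} K] :=
  ObjectProperty.FullSubcategory (IsSmallPresheaf.{v₁} (C := K))

/-- The object of `Σ𝒦` given by a small family of objects of `𝒦`. -/
noncomputable def famObj {K : Type u₁} [Category.{v₁} K] {I : Type v₁} (B : I → K) :
    SigmaCompletion K :=
  ⟨∐ fun i => yoneda.obj (B i), ⟨I, B, ⟨Iso.refl _⟩⟩⟩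

theorem isSmallPresheaf_coprod {K : Type u₁} [Category.{v₁} K] {I : Type v₁} (B : I → K) :
    IsSmallPresheaf.{v₁} (∐ fun i => yoneda.obj (B i)) := by
  let G := Discrete.functor (fun i => yoneda.obj (B i))
  let e : Discrete.functor B ⋙ yoneda ≅ G := Discrete.natIso (fun i => Iso.refl _)
  exact ⟨Discrete I, inferInstance, Discrete.functor B,
    (Cocone.precompose e.hom).obj (colimit.cocone G),
    ⟨(IsColimit.precomposeHomEquiv e (colimit.cocone G)).symm (colimit.isColimit G)⟩,
    ⟨Iso.refl _⟩⟩

/-- The object of `𝒫𝒦` given by a small coproduct of representables. -/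
noncomputable def pcoprodObj {K : Type u₁} [Category.{v₁} K] {I : Type v₁} (B : I → K) :
    PCompletion K :=
  ⟨∐ fun i => yoneda.obj (B i), isSmallPresheaf_coprod B⟩

/-- A diagram `D` has a *multi-limit*: a set of cones through which every cone
factorizes uniquely (unique member and unique factorization). -/
def HasMultiLimit {J : Type w₁} [Category.{w₂} J] {C : Type u₁} [Category.{v₁} C]
    (D : J ⥤ C) : Prop :=
  ∃ (T : Type w) (c : T → Cone D), ∀ s : Cone D,
    ∃ p : Σ t : T, s ⟶ c t, ∀ q : Σ t : T, s ⟶ c t, q = p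

/-- `𝒦` is finitely multi-complete: every finite diagram has a multi-limit. -/
def FinitelyMultiComplete (C : Type u₁) [Category.{v₁} C] : Prop :=
  ∀ (J : Type) [SmallCategory J] [FinCategory J] (D : J ⥤ C), HasMultiLimit.{v₁} D

/-- A family `A : I → C` has a *multi-product*: a set of cones through which every cone
factorizes uniquely (unique member and unique factorization). -/
def HasMultiProduct {C : Type u₁} [Category.{v₁} C] {I : Type w₁} (A : I → C) : Prop :=
  ∃ (T : Type w) (P : T → C) (π : ∀ t i, P t ⟶ A i),
    ∀ (X : C) (f : ∀ i, X ⟶ A i),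
      ∃ p : Σ t : T, X ⟶ P t, (∀ i, p.2 ≫ π p.1 i = f i) ∧
        ∀ q : Σ t : T, X ⟶ P t, (∀ i, q.2 ≫ π q.1 i = f i) → q = p

/-- `C` has multi-products of all set-indexed families. -/
def HasMultiProducts (C : Type u₁) [Category.{v₁} C] : Prop :=
  ∀ (I : Type v₁) (A : I → C), HasMultiProduct.{v₁} A

/-- A diagram `D` has a *pre-limit*: a set of cones through which every cone
factorizes (not necessarily uniquely). -/
def HasPreLimit {J : Type w₁} [Category.{w₂} J] {C : Type u₁} [Category.{v₁} C]
    (D : J ⥤ C) : Prop :=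
  ∃ (T : Type w) (c : T → Cone D), ∀ s : Cone D, ∃ t : T, Nonempty (s ⟶ c t)

/-- `C` is pre-complete: every small diagram has a pre-limit. -/
def PreComplete (C : Type u₁) [Category.{v₁} C] : Prop :=
  ∀ (J : Type v₁) [SmallCategory J] (D : J ⥤ C), HasPreLimit.{v₁} D

/-- `C` is finitely pre-complete: every finite diagram has a pre-limit. -/
def FinitelyPreComplete (C : Type u₁) [Category.{v₁} C] : Prop :=
  ∀ (J : Type) [SmallCategory J] [FinCategory J] (D : J ⥤ C), HasPreLimit.{v₁} D

/-- A family `A : I → C` has a *pre-product*: a set of cones through which every cone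
factorizes (not necessarily uniquely). -/
def HasPreProduct {C : Type u₁} [Category.{v₁} C] {I : Type w₁} (A : I → C) : Prop :=
  ∃ (T : Type w) (P : T → C) (π : ∀ t i, P t ⟶ A i),
    ∀ (X : C) (f : ∀ i, X ⟶ A i), ∃ (t : T) (h : X ⟶ P t), ∀ i, h ≫ π t i = f i

/-- `C` (with finite products) is cartesian multi-closed: each functor `A × -` is a
left multi-adjoint. -/
def CartesianMultiClosedOf (C : Type u₁) [Category.{v₁} C] [HasFiniteProducts C] : Prop :=
  ∀ A B : C, ∃ (I : Type v₁) (E : I → C) (ev : ∀ i, A ⨯ E i ⟶ B),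
    ∀ (X : C) (c : A ⨯ X ⟶ B),
      ∃ p : Σ i : I, X ⟶ E i, (prod.map (𝟙 A) p.2 ≫ ev p.1 = c) ∧
        ∀ q : Σ i : I, X ⟶ E i, prod.map (𝟙 A) q.2 ≫ ev q.1 = c → q = p

/-- `C` is cartesian multi-closed: it has finite products and each functor `A × -` is a
left multi-adjoint. -/
def CartesianMultiClosed (C : Type u₁) [Category.{v₁} C] : Prop :=
  ∃ h : HasFiniteProducts C, @CartesianMultiClosedOf C _ h

/-- `C` is cartesian closed (as a property: it has finite products and each `A × -`
is a left adjoint). -/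
def CartesianClosedP (C : Type u₁) [Category.{v₁} C] : Prop :=
  ∃ h : CartesianMonoidalCategory C, Nonempty (MonoidalClosed C)

/-- `C` is locally cartesian closed: every slice category is cartesian closed. -/
def LocallyCartesianClosedP (C : Type u₁) [Category.{v₁} C] : Prop :=
  ∀ A : C, CartesianClosedP (Over A)

/-- `C` is locally cartesian multi-closed: every slice category is cartesian multi-closed. -/
def LocallyCartesianMultiClosed (C : Type u₁) [Category.{v₁} C] : Prop :=
  ∀ A : C, CartesianMultiClosed (Over A)

/-- `C` (with finite products) is cartesian pre-closed: each functor `C(A × -, B)`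
is a small presheaf. -/
def CartesianPreClosedOf (C : Type u₁) [Category.{v₁} C] [HasFiniteProducts C] : Prop :=
  ∀ A B : C, IsSmallPresheaf.{w} ((prod.functor.obj A).op ⋙ yoneda.obj B)

/-- `C` is cartesian pre-closed: it has finite products and each functor `C(A × -, B)`
is a small presheaf. -/
def CartesianPreClosed (C : Type u₁) [Category.{v₁} C] : Prop :=
  ∃ h : HasFiniteProducts C, @CartesianPreClosedOf.{w} C _ h

/-- `C` (with binary products) has weak simple products. -/
def HasWeakSimpleProductsOf (C : Type u₁) [Category.{v₁} C] [HasBinaryProducts C] : Prop :=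
  ∀ (A X B : C) (b : B ⟶ A ⨯ X),
    ∃ (P : C) (ε : A ⨯ P ⟶ B) (w : P ⟶ X),
      ε ≫ b = prod.map (𝟙 A) w ∧
      ∀ (P' : C) (ε' : A ⨯ P' ⟶ B) (w' : P' ⟶ X), ε' ≫ b = prod.map (𝟙 A) w' →
        ∃ f : P' ⟶ P, ε' = prod.map (𝟙 A) f ≫ ε ∧ w' = f ≫ w

/-- `C` has binary products and weak simple products. -/
def HasWeakSimpleProducts (C : Type u₁) [Category.{v₁} C] : Prop :=
  ∃ h : HasBinaryProducts C, @HasWeakSimpleProductsOf C _ h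

/-- `C` has a subobject classifier: a mono `ε : 1 ⟶ Ω` from the terminal object such that
every monomorphism is a pullback of `ε` along a unique morphism. -/
def HasSubobjectClassifierP (C : Type u₁) [Category.{v₁} C] : Prop :=
  ∃ (T Ω : C) (hT : IsTerminal T) (ε : T ⟶ Ω), Mono ε ∧
    ∀ ⦃U X : C⦄ (m : U ⟶ X), Mono m → ∃! χ : X ⟶ Ω, IsPullback (hT.from U) m ε χ

/-- `C` is an elementary topos: finitely complete, cartesian closed,
with a subobject classifier. -/
def IsElementaryTopos (C : Type u₁) [Category.{v₁} C] : Prop :=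
  HasFiniteLimits C ∧ CartesianClosedP C ∧ HasSubobjectClassifierP C

/-- `C` is a multi-topos: finitely complete, cartesian multi-closed,
with a subobject classifier. -/
def IsMultiTopos (C : Type u₁) [Category.{v₁} C] : Prop :=
  HasFiniteLimits C ∧ CartesianMultiClosed C ∧ HasSubobjectClassifierP C

/-- A coproduct cocone is *universal*: it is stable under pullback. -/
def CofanUniversal {C : Type u₁} [Category.{v₁} C] {I : Type w₁} {X : I → C}
    (c : Cofan X) : Prop :=
  ∀ {W : C} (h : W ⟶ c.pt) (Y : I → C) (p : ∀ i, Y i ⟶ W) (q : ∀ i, Y i ⟶ X i),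
    (∀ i, IsPullback (p i) (q i) h (c.inj i)) → Nonempty (IsColimit (Cofan.mk W p))

/-- A coproduct cocone is *disjoint*: injections are monic with initial pairwise
intersections. -/
def CofanDisjoint {C : Type u₁} [Category.{v₁} C] {I : Type w₁} {X : I → C}
    (c : Cofan X) : Prop :=
  (∀ i, Mono (c.inj i)) ∧
    ∀ i j, i ≠ j → ∀ {Z : C} (u : Z ⟶ X i) (v : Z ⟶ X j),
      IsPullback u v (c.inj i) (c.inj j) → Nonempty (IsInitial Z)

/-- `C` is extensive: finitely complete, with finite coproducts which are
universal and disjoint. -/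
def IsExtensive (C : Type u₁) [Category.{v₁} C] : Prop :=
  HasFiniteLimits C ∧ HasFiniteCoproducts C ∧
    ∀ (I : Type) [Finite I] (X : I → C) (c : Cofan X),
      Nonempty (IsColimit c) → CofanUniversal c ∧ CofanDisjoint c

/-- `C` is infinitary extensive: finitely complete, with small (`Type w`-indexed)
coproducts which are universal and disjoint. -/
def IsInfinitaryExtensive (C : Type u₁) [Category.{v₁} C] : Prop :=
  HasFiniteLimits C ∧ HasCoproducts.{w} C ∧
    ∀ (I : Type w) (X : I → C) (c : Cofan X),
      Nonempty (IsColimit c) → CofanUniversal c ∧ CofanDisjoint c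

/-- A parallel pair `r₁ r₂ : R ⟶ X` is an (internal) equivalence relation. -/
structure IsEquivalenceRelationPair {C : Type u₁} [Category.{v₁} C] {R X : C}
    (r₁ r₂ : R ⟶ X) : Prop where
  jointlyMono : ∀ {Z : C} (a b : Z ⟶ R), a ≫ r₁ = b ≫ r₁ → a ≫ r₂ = b ≫ r₂ → a = b
  refl : ∀ {Z : C} (f : Z ⟶ X), ∃ d : Z ⟶ R, d ≫ r₁ = f ∧ d ≫ r₂ = f
  symm : ∃ s : R ⟶ R, s ≫ r₁ = r₂ ∧ s ≫ r₂ = r₁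
  trans : ∀ {Z : C} (a b : Z ⟶ R), a ≫ r₂ = b ≫ r₁ →
    ∃ t : Z ⟶ R, t ≫ r₁ = a ≫ r₁ ∧ t ≫ r₂ = b ≫ r₂

/-- `C` is a regular category: finitely complete, with (regular epi, mono)
factorizations, and regular epimorphisms are stable under pullback. -/
def IsRegularCat (C : Type u₁) [Category.{v₁} C] : Prop :=
  HasFiniteLimits C ∧
    (∀ {X Y : C} (f : X ⟶ Y), ∃ (Z : C) (e : X ⟶ Z) (m : Z ⟶ Y),
      e ≫ m = f ∧ Nonempty (RegularEpi e) ∧ Mono m) ∧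
    (∀ {P X Y Z : C} (fst : P ⟶ X) (snd : P ⟶ Y) (f : X ⟶ Z) (g : Y ⟶ Z),
      IsPullback fst snd f g → Nonempty (RegularEpi g) → Nonempty (RegularEpi fst))

/-- `C` is an exact (Barr-exact) category: regular with effective equivalence relations. -/
def IsExactCat (C : Type u₁) [Category.{v₁} C] : Prop :=
  IsRegularCat C ∧
    ∀ {R X : C} (r₁ r₂ : R ⟶ X), IsEquivalenceRelationPair r₁ r₂ →
      ∃ (Y : C) (f : X ⟶ Y), IsPullback r₁ r₂ f f

/-- A pretopos is an exact and extensive category. -/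
def IsPretopos (C : Type u₁) [Category.{v₁} C] : Prop :=
  IsExactCat C ∧ IsExtensive C

/-- `C` is additive: preadditive with finite biproducts. -/
def IsAdditive (C : Type u₁) [Category.{v₁} C] : Prop :=
  ∃ p : Preadditive C, letI := p; HasFiniteBiproducts C

/-- `C` is wellpowered: every object has only a set of subobjects. -/
def Wellpowered (C : Type u₁) [Category.{v₁} C] : Prop :=
  ∀ X : C, Small.{w} (Subobject X)

/-- `C` is cowellpowered: every object has only a set of quotient objects. -/
def Cowellpowered (C : Type u₁) [Category.{v₁} C] : Prop :=
  ∀ X : C, Small.{w} (Subobject (Opposite.op X))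

/-- `C` has a clique-like class of objects, indexed by all ordinals. -/
def HasCliqueLikeClass (C : Type u₁) [Category.{v₁} C] : Prop :=
  ∃ (A : Ordinal.{v₁} → C) (R : MorphismProperty C),
    (∀ {X Y Z : C} (v : X ⟶ Y) (u : Y ⟶ Z), R (v ≫ u) → R u) ∧
    (∀ k, ∃ f g : A 0 ⟶ A k, f ≠ g ∧ R f ∧ R g) ∧
    ((∀ i k : Ordinal.{v₁}, 0 < i → i < k → ∀ f : A k ⟶ A i, ¬ R f) ∨
     (∀ k i : Ordinal.{v₁}, 0 < k → k < i → ∀ f : A k ⟶ A i, ¬ R f))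

/-- A presheaf is petty: a quotient of a small coproduct of representables. -/
def IsPetty {C : Type u₁} [Category.{v₁} C] (F : Cᵒᵖ ⥤ Type v₁) : Prop :=
  ∃ (I : Type v₁) (A : I → C) (e : (∐ fun i => yoneda.obj (A i)) ⟶ F), Epi e

/-- A presheaf is lucid: petty, and equalizers of pairs of morphisms from petty
presheaves into it are petty. -/
noncomputable def IsLucid {C : Type u₁} [Category.{v₁} C] (F : Cᵒᵖ ⥤ Type v₁) : Prop :=
  IsPetty F ∧ ∀ (P : Cᵒᵖ ⥤ Type v₁), IsPetty P → ∀ u₁ u₂ : P ⟶ F, IsPetty (equalizer u₁ u₂)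

section EasyDirection

universe v u

variable {K : Type u} [Category.{v} K]

theorem isSmallPresheaf_of_essentiallySmall [EssentiallySmall.{v} K] (F : Kᵒᵖ ⥤ Type v) :
    IsSmallPresheaf.{v} F := by
  have : EssentiallySmall.{v} (CostructuredArrow (yoneda (C := K)) F) :=
    (essentiallySmall_congr (CategoryOfElements.costructuredArrowYonedaEquivalence F)).1
      inferInstance
  let e := equivSmallModel.{v} (CostructuredArrow (yoneda (C := K)) F)
  exact ⟨SmallModel.{v} (CostructuredArrow (yoneda (C := K)) F), inferInstance,
    e.inverse ⋙ CostructuredArrow.proj yoneda F,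
    (Presheaf.tautologicalCocone F).whisker e.inverse,
    ⟨IsColimit.whiskerEquivalence (Presheaf.isColimitTautologicalCocone F) e.symm⟩,
    ⟨Iso.refl _⟩⟩

theorem isElementaryTopos_of_essentiallySmall [EssentiallySmall.{v} K] :
    IsElementaryTopos (PCompletion K) := by
  let i : PCompletion K ⥤ (Kᵒᵖ ⥤ Type v) := ObjectProperty.ι _
  have : i.EssSurj := ⟨fun F => ⟨⟨F, isSmallPresheaf_of_essentiallySmall F⟩, ⟨Iso.refl _⟩⟩⟩
  have : i.IsEquivalence := {
    faithful := ObjectProperty.faithful_ι _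
    full := ObjectProperty.full_ι _ }
  let e : PCompletion K ≌ ((SmallModel.{v} K)ᵒᵖ ⥤ Type v) :=
    i.asEquivalence.trans (Equivalence.congrLeft (E := Type v) (equivSmallModel.{v} K).op)
  have hfl : HasFiniteLimits (PCompletion K) :=
    ⟨fun J _ _ => Adjunction.hasLimitsOfShape_of_equivalence e.functor⟩
  refine ⟨hfl, ?_, ?_⟩
  · let : CartesianMonoidalCategory (PCompletion K) :=
      CartesianMonoidalCategory.ofHasFiniteProducts
    exact ⟨this, ⟨cartesianClosedOfEquiv e.symm⟩⟩
  · let c := (Presheaf.classifier (SmallModel.{v} K)).ofEquivalence e.symm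
    refine ⟨c.Ω₀, c.Ω, c.isTerminalΩ₀, c.truth, inferInstance, fun U X m hm => ?_⟩
    exact ⟨c.χ m, (c.isPullback m).flip, fun χ' h => c.uniq m h.flip⟩

end EasyDirection

section HardDirection

universe v u

variable {K : Type u} [Category.{v} K]

/-- Representables are small. -/
theorem isSmallPresheaf_yoneda (X : K) : IsSmallPresheaf.{v} (yoneda.obj X) := by
  let c : Cocone ((Functor.const (Discrete PUnit.{v + 1})).obj X ⋙ yoneda) :=
    { pt := yoneda.obj X
      ι := { app := fun _ => 𝟙 _ } }
  refine ⟨Discrete PUnit.{v + 1}, inferInstance, _, c, ⟨?_⟩, ⟨Iso.refl _⟩⟩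
  exact
    { desc := fun s => s.ι.app ⟨PUnit.unit⟩
      fac := fun s j => Category.id_comp _
      uniq := fun s m hm => by
        rw [← hm ⟨PUnit.unit⟩]
        exact (Category.id_comp _).symm }

/-- The representable object of `𝒫𝒦`. -/
abbrev yo (X : K) : PCompletion K := ⟨yoneda.obj X, isSmallPresheaf_yoneda X⟩

theorem small_elements (T : PCompletion K) : ∃ (J : Type v) (D : J → K),
    ∀ (X : K) (x : yo X ⟶ T), ∃ (j : J) (h : X ⟶ D j) (t : yo (D j) ⟶ T),
      x = ObjectProperty.homMk (yoneda.map h) ≫ t := by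
  obtain ⟨J, _, D, c, ⟨hc⟩, ⟨e⟩⟩ := T.property
  refine ⟨J, D.obj, fun X x => ?_⟩
  obtain ⟨j, h, hh⟩ := FunctorToTypes.jointly_surjective _ (Opposite.op X) hc
    (e.inv.app _ (yonedaEquiv x.hom))
  refine ⟨j, h, ObjectProperty.homMk (c.ι.app j ≫ e.hom), ?_⟩
  apply ObjectProperty.hom_ext
  apply yonedaEquiv.injective
  have h2 : e.hom.app _ (e.inv.app _ (yonedaEquiv x.hom)) = yonedaEquiv x.hom := by
    simp
  rw [← h2, hh]
  simp [yonedaEquiv_apply]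

theorem essentiallySmall_of_thin [Quiver.IsThin K]
    (hs : HasSubobjectClassifierP (PCompletion K)) : EssentiallySmall.{v} K := by
  obtain ⟨T, Ω, hT, ε, hε, H⟩ := hs
  obtain ⟨J, D, hD⟩ := small_elements T
  rw [essentiallySmall_iff_of_thin]
  have key : ∀ X : K, ∃ (p : Σ j : J, Ω.obj.obj (Opposite.op (D j))) (h : X ⟶ D p.1),
      IsPullback (hT.from (yo X)) (ObjectProperty.homMk (yoneda.map h) : yo X ⟶ yo (D p.1)) ε
        (ObjectProperty.homMk (yonedaEquiv.symm p.2)) := by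
    intro X
    obtain ⟨j, h, -⟩ := hD X (hT.from _)
    have : Mono h := ⟨fun _ _ _ => Subsingleton.elim _ _⟩
    have : Mono (ObjectProperty.homMk (yoneda.map h) : yo X ⟶ yo (D j)) :=
      (ObjectProperty.ι _).mono_of_mono_map (by
        change Mono (yoneda.map h); infer_instance)
    obtain ⟨χ, hχ, -⟩ := H _ this
    refine ⟨⟨j, yonedaEquiv χ.hom⟩, h, ?_⟩
    rw [Equiv.symm_apply_apply]
    exact hχ
  choose p h hp using key
  refine small_of_injective (f := fun X : Skeleton K => p ((fromSkeleton K).obj X)) ?_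
  intro X Y hXY
  have aux : ∀ (A B : K), p A = p B → Nonempty (A ⟶ B) := by
    intro A B hAB
    have key2 : ∀ q, p A = q → ∃ (h : A ⟶ D q.1),
        IsPullback (hT.from (yo A)) (ObjectProperty.homMk (yoneda.map h) : yo A ⟶ yo (D q.1)) ε
          (ObjectProperty.homMk (yonedaEquiv.symm q.2)) := by
      rintro _ rfl
      exact ⟨h A, hp A⟩
    obtain ⟨hA', hA⟩ := key2 _ hAB
    exact ⟨yoneda.preimage ((hp B).lift _ _ hA.w).hom⟩
  obtain ⟨a⟩ := aux _ _ hXY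
  obtain ⟨b⟩ := aux _ _ hXY.symm
  have i : (fromSkeleton K).obj X ≅ (fromSkeleton K).obj Y :=
    ⟨a, b, Subsingleton.elim _ _, Subsingleton.elim _ _⟩
  exact skeleton_skeletal K ⟨(fromSkeleton K).preimageIso i⟩

theorem no_classifier_of_not_thin
    (copowers : ∀ (L : K) (α : Type v), HasCoproduct (fun _ : α => L))
    (hs : HasSubobjectClassifierP (PCompletion K)) {L M : K} (f g : L ⟶ M) : f = g := by
  obtain ⟨T, Ω, hT, ε, hε, H⟩ := hs
  obtain ⟨J, D, hD⟩ := small_elements Ω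
  let N : Type v := (Σ j, L ⟶ D j) ⊕ ULift.{v} ℕ
  let α : Type v := Set N
  let P : Type v := {β : Set α // β.Nonempty ∧ Cardinal.mk β ≤ Cardinal.mk N}
  have hN : Cardinal.aleph0 ≤ Cardinal.mk N := Cardinal.aleph0_le_mk N
  have directed : ∀ β₁ β₂ : P, ∃ γ : P, β₁ ≤ γ ∧ β₂ ≤ γ := fun β₁ β₂ =>
    ⟨⟨β₁.1 ∪ β₂.1, β₁.2.1.mono Set.subset_union_left, (Cardinal.mk_union_le _ _).trans
      (Cardinal.add_le_of_le hN β₁.2.2 β₂.2.2)⟩, Set.subset_union_left, Set.subset_union_right⟩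
  let G : P ⥤ K :=
    { obj := fun β => ∐ (fun _ : β.1 => L)
      map := fun {β γ} i => Sigma.desc fun a => Sigma.ι (fun _ : γ.1 => L) ⟨a.1, leOfHom i a.2⟩
      map_id := fun β => by
        apply Sigma.hom_ext
        intro a
        simp
      map_comp := fun i j => by
        apply Sigma.hom_ext
        intro a
        simp }
  let X : K := ∐ (fun _ : α => L)
  let inc : ∀ β : P, G.obj β ⟶ X := fun β =>
    Sigma.desc fun a => Sigma.ι (fun _ : α => L) a.1
  have inc_nat : ∀ {β γ : P} (i : β ⟶ γ), G.map i ≫ inc γ = inc β := by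
    intro β γ i
    apply Sigma.hom_ext
    intro a
    simp [G, inc]
  have inc_mono : ∀ β, Mono (inc β) := by
    classical
    intro β
    obtain ⟨a₀, ha₀⟩ := β.2.1
    let r : X ⟶ G.obj β := Sigma.desc fun a =>
      if h : a ∈ β.1 then Sigma.ι (fun _ : β.1 => L) ⟨a, h⟩
      else Sigma.ι (fun _ : β.1 => L) ⟨a₀, ha₀⟩
    have hr : inc β ≫ r = 𝟙 _ := by
      apply Sigma.hom_ext
      intro a
      simp [inc, r]
      exact (Category.comp_id _).symm
    exact mono_of_mono_fac hr
  let c : Cocone (G ⋙ yoneda) :=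
    { pt := yoneda.obj X
      ι :=
        { app := fun β => yoneda.map (inc β)
          naturality := fun β γ i => by
            change yoneda.map (G.map i) ≫ yoneda.map (inc γ) = yoneda.map (inc β) ≫ 𝟙 _
            rw [← Functor.map_comp, inc_nat, Category.comp_id] } }
  let F : PCompletion K := ⟨colimit (G ⋙ yoneda), P, inferInstance, G, colimit.cocone _,
    ⟨colimit.isColimit _⟩, ⟨Iso.refl _⟩⟩
  let m : F ⟶ yo X := ObjectProperty.homMk (colimit.desc (G ⋙ yoneda) c)
  have rep : ∀ (Y : K) (x : yo Y ⟶ F), ∃ (β : P) (k : Y ⟶ G.obj β),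
      x = ObjectProperty.homMk (yoneda.map k ≫ colimit.ι (G ⋙ yoneda) β) := by
    intro Y x
    obtain ⟨β, k, hk⟩ := FunctorToTypes.jointly_surjective _ (Opposite.op Y)
      (colimit.isColimit (G ⋙ yoneda)) (yonedaEquiv x.hom)
    refine ⟨β, k, ?_⟩
    apply ObjectProperty.hom_ext
    apply yonedaEquiv.injective
    rw [hk]
    simp [yonedaEquiv_apply]
  have rep_m : ∀ (Y : K) (β : P) (k : Y ⟶ G.obj β),
      (ObjectProperty.homMk (yoneda.map k ≫ colimit.ι (G ⋙ yoneda) β) : yo Y ⟶ F) ≫ m =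
        ObjectProperty.homMk (yoneda.map (k ≫ inc β)) := by
    intro Y β k
    apply ObjectProperty.hom_ext
    simp [m, c]
  have m_inj : ∀ (Y : K) (x y : yo Y ⟶ F), x ≫ m = y ≫ m → x = y := by
    intro Y x y hxy
    obtain ⟨β₁, k₁, rfl⟩ := rep Y x
    obtain ⟨β₂, k₂, rfl⟩ := rep Y y
    obtain ⟨γ, h₁, h₂⟩ := directed β₁ β₂
    rw [rep_m, rep_m] at hxy
    have hxy' : k₁ ≫ inc β₁ = k₂ ≫ inc β₂ := by
      apply yoneda.map_injective
      exact congrArg (fun t => t.hom) hxy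
    rw [← inc_nat (homOfLE h₁), ← inc_nat (homOfLE h₂), ← Category.assoc, ← Category.assoc,
      cancel_mono] at hxy'
    apply ObjectProperty.hom_ext
    change yoneda.map k₁ ≫ colimit.ι (G ⋙ yoneda) β₁ = yoneda.map k₂ ≫ colimit.ι (G ⋙ yoneda) β₂
    rw [← colimit.w (G ⋙ yoneda) (homOfLE h₁), ← colimit.w (G ⋙ yoneda) (homOfLE h₂),
      Functor.comp_map, Functor.comp_map, ← Category.assoc, ← Category.assoc,
      ← Functor.map_comp, ← Functor.map_comp, hxy']
  have m_mono : Mono m := by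
    refine ⟨fun {Z} x y hxy => ?_⟩
    apply ObjectProperty.hom_ext
    ext Y z
    have := m_inj Y.unop (ObjectProperty.homMk (yonedaEquiv.symm z) ≫ x)
      (ObjectProperty.homMk (yonedaEquiv.symm z) ≫ y) (by
        rw [Category.assoc, Category.assoc, hxy])
    have h2 : yonedaEquiv.symm z ≫ x.hom = yonedaEquiv.symm z ≫ y.hom :=
      congrArg (fun t => t.hom) this
    have h3 := congrArg yonedaEquiv h2
    rw [yonedaEquiv_comp, yonedaEquiv_comp, Equiv.apply_symm_apply] at h3
    exact h3
  obtain ⟨χ, hχ, -⟩ := H m m_mono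
  obtain ⟨j, h, t, ht⟩ := hD X χ
  -- collapse `α` onto a small set of representatives for the components of `h`
  let φ : α → (L ⟶ D j) := fun a => Sigma.ι (fun _ : α => L) a ≫ h
  let ψ : (L ⟶ D j) → α := Function.invFun φ
  have hψ : ∀ a, φ (ψ (φ a)) = φ a := fun a => Function.invFun_eq ⟨a, rfl⟩
  let β : P := ⟨Set.range ψ, ⟨ψ (φ ∅), Set.mem_range_self _⟩, by
    refine Cardinal.mk_range_le.trans ?_
    exact Cardinal.mk_le_of_injective (f := fun k => (Sum.inl ⟨j, k⟩ : N)) (by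
      intro a b hab
      have h1 := Sum.inl.inj hab
      simpa using h1)⟩
  let r : X ⟶ G.obj β := Sigma.desc fun a =>
    Sigma.ι (fun _ : β.1 => L) ⟨ψ (φ a), Set.mem_range_self _⟩
  have hr : (r ≫ inc β) ≫ h = h := by
    apply Sigma.hom_ext
    intro a
    have := hψ a
    simpa [r, inc, φ] using this
  have hχ1 : χ = hT.from _ ≫ ε := by
    have e1 : (ObjectProperty.homMk (yoneda.map (r ≫ inc β)) : yo X ⟶ yo X) ≫ χ = χ := by
      rw [ht, ← Category.assoc]
      congr 1
      apply ObjectProperty.hom_ext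
      change yoneda.map _ ≫ yoneda.map _ = yoneda.map _
      rw [← Functor.map_comp, hr]
    rw [← e1, ← rep_m, Category.assoc, ← hχ.w, ← Category.assoc]
    congr 1
    exact hT.hom_ext _ _
  let s : yo X ⟶ F := hχ.lift (hT.from _) (𝟙 _) (by rw [Category.id_comp, hχ1])
  have hs : s ≫ m = 𝟙 _ := hχ.lift_snd _ _ _
  obtain ⟨γ, k, hk⟩ := rep X s
  rw [hk, rep_m] at hs
  have hk1 : k ≫ inc γ = 𝟙 X := by
    apply yoneda.map_injective
    rw [CategoryTheory.Functor.map_id]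
    exact congrArg (fun t => t.hom) hs
  have hγ : ∃ b, b ∉ γ.1 := by
    by_contra hcon
    push Not at hcon
    have hu : γ.1 = Set.univ := Set.eq_univ_of_forall hcon
    have h1 := γ.2.2
    rw [hu, Cardinal.mk_univ, Cardinal.mk_set] at h1
    exact absurd h1 (not_le.2 (Cardinal.cantor _))
  obtain ⟨b, hb⟩ := hγ
  classical
  let u₁ : X ⟶ M := Sigma.desc fun _ => f
  let u₂ : X ⟶ M := Sigma.desc fun a => if a = b then g else f
  have hu : inc γ ≫ u₁ = inc γ ≫ u₂ := by
    apply Sigma.hom_ext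
    intro a
    have : a.1 ≠ b := fun hab => hb (hab ▸ a.2)
    simp [inc, u₁, u₂, this]
  have hu' : u₁ = u₂ := by
    rw [← Category.id_comp u₁, ← Category.id_comp u₂, ← hk1, Category.assoc, Category.assoc, hu]
  have := congrArg (fun u => Sigma.ι (fun _ : α => L) b ≫ u) hu'
  simpa [u₁, u₂] using this

end HardDirection

universe v u

/-- Theorem 4.3: if `𝒦` has copowers and finite intersections, then
`𝒫𝒦` is an elementary topos iff `𝒦` is essentially small. -/
theorem pCompletion_topos_iff_essentiallySmall (K : Type u) [Category.{v} K]
    (copowers : ∀ (L : K) (α : Type v), HasCoproduct (fun _ : α => L))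
    (intersections : ∀ {X Y Z : K} (f : X ⟶ Z) (g : Y ⟶ Z), Mono f → Mono g →
      HasPullback f g) :
    IsElementaryTopos (PCompletion K) ↔ EssentiallySmall.{v} K := by
  constructor
  · rintro ⟨-, -, hs⟩
    have : Quiver.IsThin K := fun L M => ⟨fun f g => no_classifier_of_not_thin copowers hs f g⟩
    exact essentiallySmall_of_thin hs
  · intro h
    exact isElementaryTopos_of_essentiallySmall
end FreeCompletions
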